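/- arXiv:2308.02155 — 2 statements merged into one kernel-verified Lean document; each statement's English description precedes it below -/
import Mathlib

section
/- Let n ≥ 1, let 0 ≤ k ≤ n, and let w = (w₁,…,wₙ) be a weight with each wᵢ > 0. Consider the action of ℝ_{>0} on ([0,∞) × ℝⁿ_k) \ ([0,∞) × {0}) given by t·(x₀,x) := (t⁻¹x₀, t^{w₁}x₁,…,t^{wₙ}xₙ). Then the map F : Sⁿ⁻¹_k × [0,∞) → ([0,∞) × ℝⁿ_k \ [0,∞) × {0}) / ℝ_{>0} defined by F(ω,t) := (orbit of (t,ω)) is a homeomorphism onto the orbit space equipped with the quotient topology. (This identifies the weighted blow-up [ℝⁿ_k;{0}]_w with Sⁿ⁻¹_k × [0,∞).) -/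
/-- The model quadrant `ℝⁿ_k = [0,∞)^k × ℝ^{n-k}`. -/
def quadrant (n k : ℕ) : Set (Fin n → ℝ) :=
  {x | ∀ i : Fin n, (i : ℕ) < k → 0 ≤ x i}

/-- The unit sphere in the quadrant, `Sⁿ⁻¹_k`. -/
def sphereK (n k : ℕ) : Set (Fin n → ℝ) :=
  {x ∈ quadrant n k | ∑ i, x i ^ 2 = 1}

/-- The weighted `ℝ_{>0}`-action `t · x = (t^{w₁}x₁, …, t^{wₙ}xₙ)` on `ℝⁿ_k`. -/
noncomputable def wAct (n : ℕ) (w : Fin n → ℝ) (t : ℝ) (x : Fin n → ℝ) : Fin n → ℝ :=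
  fun i => t ^ w i * x i

/-- The domain `([0,∞) × ℝⁿ_k) \ ([0,∞) × {0})` of the weighted blow-up. -/
def blowupDom (n k : ℕ) : Set (ℝ × (Fin n → ℝ)) :=
  {p | 0 ≤ p.1 ∧ p.2 ∈ quadrant n k ∧ p.2 ≠ 0}

/-- The orbit relation of the `ℝ_{>0}`-action `t · (x₀, x) = (t⁻¹ x₀, t^{w} x)`. -/
def blowupRel (n k : ℕ) (w : Fin n → ℝ) (p q : blowupDom n k) : Prop :=
  ∃ t : ℝ, 0 < t ∧
    (q : ℝ × (Fin n → ℝ)) =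
      (t⁻¹ * (p : ℝ × (Fin n → ℝ)).1, wAct n w t (p : ℝ × (Fin n → ℝ)).2)

/-- The weighted blow-up `[ℝⁿ_k;{0}]_w`, i.e. the quotient of the domain by the
`ℝ_{>0}`-action, with the quotient topology. -/
def weightedBlowup (n k : ℕ) (w : Fin n → ℝ) : Type :=
  Quot (blowupRel n k w)

instance (n k : ℕ) (w : Fin n → ℝ) : TopologicalSpace (weightedBlowup n k w) :=
  instTopologicalSpaceQuot

/-- The map `F(ω, t) :=` (orbit of `(t, ω)`). -/
def Fmap (n k : ℕ) (w : Fin n → ℝ) (p : sphereK n k × Set.Ici (0 : ℝ)) :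
    weightedBlowup n k w :=
  Quot.mk _ ⟨(p.2.1, p.1.1), by
    obtain ⟨h1, h2⟩ := p.1.2
    refine ⟨p.2.2, h1, ?_⟩
    intro h0
    have h0' : (p.1 : Fin n → ℝ) = 0 := h0
    rw [h0'] at h2
    simp at h2⟩

open Set Topology

section WeightedAction

variable {n k : ℕ} {w : Fin n → ℝ} {x : Fin n → ℝ}

lemma wAct_one (x : Fin n → ℝ) : wAct n w 1 x = x := by
  funext i
  simp [wAct]

lemma wAct_mul {s t : ℝ} (hs : 0 ≤ s) (ht : 0 ≤ t) (x : Fin n → ℝ) :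
    wAct n w (s * t) x = wAct n w s (wAct n w t x) := by
  funext i
  simp [wAct, Real.mul_rpow hs ht, mul_assoc]

lemma wAct_mem_quadrant {t : ℝ} (ht : 0 ≤ t) (hx : x ∈ quadrant n k) :
    wAct n w t x ∈ quadrant n k :=
  fun i hi => mul_nonneg (Real.rpow_nonneg ht _) (hx i hi)

lemma continuous_wAct (hw : ∀ i, 0 < w i) :
    Continuous fun p : ℝ × (Fin n → ℝ) => wAct n w p.1 p.2 := by
  refine continuous_pi fun i => ?_
  exact (continuous_fst.rpow_const fun _ => Or.inr (hw i).le).mul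
    ((continuous_apply i).comp continuous_snd)

/-- The squared Euclidean norm of `s · x`. -/
noncomputable def wNormSq (w : Fin n → ℝ) (s : ℝ) (x : Fin n → ℝ) : ℝ :=
  ∑ i, wAct n w s x i ^ 2

lemma continuous_wNormSq (hw : ∀ i, 0 < w i) :
    Continuous fun p : ℝ × (Fin n → ℝ) => wNormSq w p.1 p.2 :=
  continuous_finsetSum _ fun i _ =>
    ((continuous_apply i).comp (continuous_wAct hw)).pow 2

lemma wNormSq_mul {s t : ℝ} (hs : 0 ≤ s) (ht : 0 ≤ t) (x : Fin n → ℝ) :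
    wNormSq w (s * t) x = wNormSq w s (wAct n w t x) := by
  simp only [wNormSq, wAct_mul hs ht]

lemma strictMonoOn_wNormSq (hw : ∀ i, 0 < w i) (hx : x ≠ 0) :
    StrictMonoOn (fun s => wNormSq w s x) (Ici 0) := by
  intro a ha b _ hab
  have ha : 0 ≤ a := ha
  obtain ⟨j, hj⟩ := Function.ne_iff.mp hx
  have hpow (i : Fin n) : (a ^ w i) ^ 2 < (b ^ w i) ^ 2 :=
    pow_lt_pow_left₀ (Real.rpow_lt_rpow ha hab (hw i)) (Real.rpow_nonneg ha _) two_ne_zero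
  refine Finset.sum_lt_sum (fun i _ => ?_) ⟨j, Finset.mem_univ j, ?_⟩
  · simp only [wAct, mul_pow]
    exact mul_le_mul_of_nonneg_right (hpow i).le (sq_nonneg _)
  · simp only [wAct, mul_pow]
    exact mul_lt_mul_of_pos_right (hpow j) (sq_pos_of_ne_zero hj)

lemma wNormSq_zero (hw : ∀ i, 0 < w i) (x : Fin n → ℝ) : wNormSq w 0 x = 0 := by
  simp [wNormSq, wAct, Real.zero_rpow (hw _).ne']

lemma exists_wNormSq_eq_one (hw : ∀ i, 0 < w i) (hx : x ≠ 0) :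
    ∃ s, 0 < s ∧ wNormSq w s x = 1 := by
  obtain ⟨j, hj⟩ := Function.ne_iff.mp hx
  have hj : 0 < |x j| := abs_pos.mpr hj
  set b : ℝ := |x j|⁻¹ ^ (w j)⁻¹ with hb
  have hb0 : 0 ≤ b := by positivity
  have hb1 : 1 ≤ wNormSq w b x := by
    have h : wAct n w b x j ^ 2 = 1 := by
      rw [wAct, hb, Real.rpow_inv_rpow (by positivity) (hw j).ne', mul_pow, inv_pow, sq_abs,
        inv_mul_cancel₀ (sq_pos_of_ne_zero (abs_pos.mp hj)).ne']
    rw [← h]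
    exact Finset.single_le_sum (f := fun i => wAct n w b x i ^ 2)
      (fun i _ => sq_nonneg _) (Finset.mem_univ j)
  have hcont : Continuous fun s => wNormSq w s x :=
    (continuous_wNormSq hw).comp (Continuous.prodMk_left x)
  obtain ⟨s, hs, hs1⟩ := intermediate_value_Icc hb0 hcont.continuousOn
    (show (1 : ℝ) ∈ Icc _ _ from ⟨by simp [wNormSq_zero hw], hb1⟩)
  refine ⟨s, hs.1.lt_of_ne ?_, hs1⟩
  rintro rfl
  simp [wNormSq_zero hw] at hs1

/-- For `x ≠ 0`, the unique `s > 0` such that `s · x` lies on the unit sphere. -/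
noncomputable def sphereScale (w : Fin n → ℝ) (x : Fin n → ℝ) : ℝ :=
  Classical.epsilon fun s => 0 < s ∧ wNormSq w s x = 1

lemma sphereScale_pos (hw : ∀ i, 0 < w i) (hx : x ≠ 0) : 0 < sphereScale w x :=
  (Classical.epsilon_spec (exists_wNormSq_eq_one hw hx)).1

lemma wNormSq_sphereScale (hw : ∀ i, 0 < w i) (hx : x ≠ 0) :
    wNormSq w (sphereScale w x) x = 1 :=
  (Classical.epsilon_spec (exists_wNormSq_eq_one hw hx)).2

lemma sphereScale_eq (hw : ∀ i, 0 < w i) (hx : x ≠ 0) {s : ℝ} (hs : 0 ≤ s)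
    (h : wNormSq w s x = 1) : sphereScale w x = s :=
  (strictMonoOn_wNormSq hw hx).injOn (sphereScale_pos hw hx).le hs
    ((wNormSq_sphereScale hw hx).trans h.symm)

lemma continuousAt_sphereScale (hw : ∀ i, 0 < w i) (hx : x ≠ 0) :
    ContinuousAt (sphereScale w) x := by
  have hcont (s : ℝ) : Continuous fun y => wNormSq w s y :=
    (continuous_wNormSq hw).comp (Continuous.prodMk_right s)
  have hne : ∀ᶠ y in 𝓝 x, y ≠ 0 := isOpen_ne.mem_nhds hx
  have h1 := wNormSq_sphereScale hw hx
  refine tendsto_order.mpr ⟨fun a ha => ?_, fun b hb => ?_⟩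
  · rcases lt_or_ge a 0 with ha0 | ha0
    · filter_upwards [hne] with y hy using ha0.trans (sphereScale_pos hw hy)
    · have hlt : wNormSq w a x < 1 :=
        h1 ▸ strictMonoOn_wNormSq hw hx ha0 (sphereScale_pos hw hx).le ha
      filter_upwards [hne, (hcont a).continuousAt.eventually_lt_const hlt] with y hy hya
      rw [← wNormSq_sphereScale hw hy] at hya
      exact ((strictMonoOn_wNormSq hw hy).lt_iff_lt ha0 (sphereScale_pos hw hy).le).mp hya
  · have hb0 : 0 ≤ b := (sphereScale_pos hw hx).le.trans hb.le
    have hlt : 1 < wNormSq w b x :=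
      h1 ▸ strictMonoOn_wNormSq hw hx (sphereScale_pos hw hx).le hb0 hb
    filter_upwards [hne, (hcont b).continuousAt.eventually_const_lt hlt] with y hy hyb
    rw [← wNormSq_sphereScale hw hy] at hyb
    exact ((strictMonoOn_wNormSq hw hy).lt_iff_lt (sphereScale_pos hw hy).le hb0).mp hyb

lemma sphereScale_wAct (hw : ∀ i, 0 < w i) (hx : x ≠ 0) {t : ℝ} (ht : 0 < t)
    (htx : wAct n w t x ≠ 0) : sphereScale w (wAct n w t x) = sphereScale w x * t⁻¹ := by
  have h0 : 0 ≤ sphereScale w x * t⁻¹ :=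
    mul_nonneg (sphereScale_pos hw hx).le (inv_nonneg.mpr ht.le)
  refine sphereScale_eq hw htx h0 ?_
  rw [← wNormSq_mul h0 ht.le, inv_mul_cancel_right₀ ht.ne', wNormSq_sphereScale hw hx]

end WeightedAction

section Blowup

variable {n k : ℕ} {w : Fin n → ℝ}

/-- The representative of the orbit of `p` with second component on the unit sphere. -/
noncomputable def blowupNormalize (hw : ∀ i, 0 < w i) (p : blowupDom n k) :
    sphereK n k × Ici (0 : ℝ) :=
  (⟨wAct n w (sphereScale w p.1.2) p.1.2,
    wAct_mem_quadrant (sphereScale_pos hw p.2.2.2).le p.2.2.1,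
    wNormSq_sphereScale hw p.2.2.2⟩,
   ⟨(sphereScale w p.1.2)⁻¹ * p.1.1,
    mul_nonneg (inv_nonneg.mpr (sphereScale_pos hw p.2.2.2).le) p.2.1⟩)

lemma continuous_blowupNormalize (hw : ∀ i, 0 < w i) :
    Continuous (blowupNormalize hw : blowupDom n k → _) := by
  have hsnd : Continuous fun p : blowupDom n k => p.1.2 :=
    continuous_snd.comp continuous_subtype_val
  have hscale : Continuous fun p : blowupDom n k => sphereScale w p.1.2 :=
    continuous_iff_continuousAt.mpr fun p =>
      (continuousAt_sphereScale hw p.2.2.2).comp_of_eq hsnd.continuousAt rfl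
  refine Continuous.prodMk (Continuous.subtype_mk ?_ _) (Continuous.subtype_mk ?_ _)
  · exact (continuous_wAct hw).comp (hscale.prodMk hsnd)
  · exact (hscale.inv₀ fun p => (sphereScale_pos hw p.2.2.2).ne').mul
      (continuous_fst.comp continuous_subtype_val)

lemma blowupNormalize_eq_of_blowupRel (hw : ∀ i, 0 < w i) {p q : blowupDom n k}
    (h : blowupRel n k w p q) : blowupNormalize hw p = blowupNormalize hw q := by
  obtain ⟨⟨a, x⟩, hp⟩ := p
  obtain ⟨⟨b, y⟩, hq⟩ := q
  obtain ⟨t, ht, h⟩ := h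
  obtain ⟨rfl, rfl⟩ := Prod.mk.inj h
  have hs := sphereScale_wAct hw hp.2.2 ht hq.2.2
  have hs0 := sphereScale_pos hw hp.2.2
  dsimp only at hs hs0
  refine Prod.ext (Subtype.ext ?_) (Subtype.ext ?_)
  · dsimp only [blowupNormalize]
    rw [hs, ← wAct_mul (by positivity) ht.le, inv_mul_cancel_right₀ ht.ne']
  · dsimp only [blowupNormalize]
    rw [hs]
    field_simp

lemma continuous_Fmap : Continuous (Fmap n k w) := by
  refine continuous_quot_mk.comp (Continuous.subtype_mk ?_ _)
  fun_prop

/-- The inverse of `Fmap`. -/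
noncomputable def FmapInv (hw : ∀ i, 0 < w i) :
    weightedBlowup n k w → sphereK n k × Ici (0 : ℝ) :=
  Quot.lift (blowupNormalize hw) fun _ _ => blowupNormalize_eq_of_blowupRel hw

lemma FmapInv_Fmap (hw : ∀ i, 0 < w i) (p : sphereK n k × Ici (0 : ℝ)) :
    FmapInv hw (Fmap n k w p) = p := by
  have hne : p.1.1 ≠ 0 := by
    intro h
    simpa [h] using p.1.2.2
  have hs : sphereScale w p.1.1 = 1 := by
    refine sphereScale_eq hw hne zero_le_one ?_
    rw [wNormSq, wAct_one]
    exact p.1.2.2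
  refine Prod.ext (Subtype.ext ?_) (Subtype.ext ?_)
  · simp [FmapInv, Fmap, blowupNormalize, hs, wAct_one]
  · simp [FmapInv, Fmap, blowupNormalize, hs]

lemma Fmap_FmapInv (hw : ∀ i, 0 < w i) (q : weightedBlowup n k w) :
    Fmap n k w (FmapInv hw q) = q := by
  obtain ⟨p, rfl⟩ := Quot.exists_rep q
  exact (Quot.sound ⟨sphereScale w p.1.2, sphereScale_pos hw p.2.2.2, rfl⟩).symm

/-- `Fmap` as a homeomorphism. -/
noncomputable def FmapHomeomorph (hw : ∀ i, 0 < w i) :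
    (sphereK n k × Ici (0 : ℝ)) ≃ₜ weightedBlowup n k w where
  toFun := Fmap n k w
  invFun := FmapInv hw
  left_inv := FmapInv_Fmap hw
  right_inv := Fmap_FmapInv hw
  continuous_toFun := continuous_Fmap
  continuous_invFun := continuous_quot_lift _ (continuous_blowupNormalize hw)

end Blowup

theorem stmt1 (n k : ℕ) (hn : 1 ≤ n) (hk : k ≤ n) (w : Fin n → ℝ) (hw : ∀ i, 0 < w i) :
    ∃ F : (sphereK n k × Set.Ici (0 : ℝ)) ≃ₜ weightedBlowup n k w,
      ∀ p : sphereK n k × Set.Ici (0 : ℝ), F p = Fmap n k w p :=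
  ⟨FmapHomeomorph hw, fun _ => rfl⟩
end

section
/- Let w : {1,…,n} → ℝ_{>0} be a weight, let I ⊆ {1,…,n}, let i, j ∈ I with i ≠ j, and let p, q ∈ {+1,−1}. Let x ∈ ℝⁿ satisfy p·xᵢ > 0 and q·xⱼ > 0. For a ∈ I, a sign s with s·x_a > 0, and an index m, define ζ_{a,m,s} := (s·x_a)^{1/w_a} if m = a; ζ_{a,m,s} := (s·x_a)^{−w_m/w_a}·x_m if m ∈ I \ {a}; and ζ_{a,m,s} := x_m if m ∉ I. Then the following transition identities hold: (1) ζ_{j,i,q} = p·(q·ζ_{i,j,p})^{−wᵢ/wⱼ}; (2) ζ_{j,j,q} = (q·ζ_{i,j,p})^{1/wⱼ}·ζ_{i,i,p}; (3) for every m ∈ I \ {i,j}, ζ_{j,m,q} = (q·ζ_{i,j,p})^{−w_m/wⱼ}·ζ_{i,m,p}; and (4) for every m ∉ I, ζ_{j,m,q} = ζ_{i,m,p}. (Here all real powers are well defined since q·ζ_{i,j,p} = (p·xᵢ)^{−wⱼ/wᵢ}·(q·xⱼ) > 0.) -/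
/-- The projective coordinates `ζ_{a,m,s}` on the weighted blow-up of the linear
subspace `{x_m = 0, m ∈ I}` of `ℝⁿ` with respect to the weight `w`. -/
noncomputable def zeta (n : ℕ) (w : Fin n → ℝ) (I : Finset (Fin n)) (x : Fin n → ℝ)
    (a : Fin n) (s : ℝ) (m : Fin n) : ℝ :=
  if m = a then (s * x a) ^ (1 / w a)
  else if m ∈ I then (s * x a) ^ (-(w m / w a)) * x m
  else x m

/-- Rescaling by a power of `A` composes multiplicatively inside a real power. -/
theorem rpow_mul_rpow_of_pos {A B : ℝ} (hA : 0 < A) (hB : 0 < B) (c r : ℝ) :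
    (A ^ c * B) ^ r = A ^ (c * r) * B ^ r := by
  rw [Real.mul_rpow (Real.rpow_nonneg hA.le c) hB.le, ← Real.rpow_mul hA.le]

theorem stmt4 (n : ℕ) (w : Fin n → ℝ) (hw : ∀ i, 0 < w i) (I : Finset (Fin n))
    (i j : Fin n) (hi : i ∈ I) (hj : j ∈ I) (hij : i ≠ j)
    (p q : ℝ) (hp : p = 1 ∨ p = -1) (hq : q = 1 ∨ q = -1)
    (x : Fin n → ℝ) (hpx : 0 < p * x i) (hqx : 0 < q * x j) :
    0 < q * zeta n w I x i p j ∧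
    zeta n w I x j q i = p * (q * zeta n w I x i p j) ^ (-(w i / w j)) ∧
    zeta n w I x j q j = (q * zeta n w I x i p j) ^ (1 / w j) * zeta n w I x i p i ∧
    (∀ m ∈ I, m ≠ i → m ≠ j →
      zeta n w I x j q m = (q * zeta n w I x i p j) ^ (-(w m / w j)) * zeta n w I x i p m) ∧
    (∀ m, m ∉ I → zeta n w I x j q m = zeta n w I x i p m) := by
  have hwi := (hw i).ne'
  have hwj := (hw j).ne'
  have hpp : p * p = 1 := by rcases hp with rfl | rfl <;> norm_num
  have key : q * zeta n w I x i p j = (p * x i) ^ (-(w j / w i)) * (q * x j) := by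
    simp only [zeta, if_neg hij.symm, if_pos hj]
    ring
  rw [key]
  refine ⟨by positivity, ?_, ?_, ?_, ?_⟩
  · rw [rpow_mul_rpow_of_pos hpx hqx,
      show -(w j / w i) * -(w i / w j) = 1 by field_simp, Real.rpow_one]
    simp only [zeta, if_neg hij, if_pos hi]
    linear_combination (-(q * x j) ^ (-(w i / w j)) * x i) * hpp
  · rw [rpow_mul_rpow_of_pos hpx hqx,
      show -(w j / w i) * (1 / w j) = -(1 / w i) by field_simp, Real.rpow_neg hpx.le]
    simp only [zeta, if_true]
    have := (Real.rpow_pos_of_pos hpx (1 / w i)).ne'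
    field_simp
  · intro m hm hmi hmj
    rw [rpow_mul_rpow_of_pos hpx hqx,
      show -(w j / w i) * -(w m / w j) = w m / w i by field_simp]
    simp only [zeta, if_neg hmi, if_neg hmj, if_pos hm]
    rw [Real.rpow_neg hpx.le]
    have := (Real.rpow_pos_of_pos hpx (w m / w i)).ne'
    field_simp
  · intro m hm
    simp only [zeta, if_neg hm, if_neg (ne_of_mem_of_not_mem hi hm).symm,
      if_neg (ne_of_mem_of_not_mem hj hm).symm]
end
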